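/- arXiv:2006.11100 — 3 statements merged into one kernel-verified Lean document; each statement's English description precedes it below -/
import Mathlib

section
/- Let α : 𝕍 → 𝕌 be a morphism between persistence modules of length n. Then for all 1 ≤ a ≤ b ≤ n: Σ_{b' = 1}^{n} Σ_{a' = 1}^{b'} M^α(a, b, a', b') ≤ dim S_{a,b}^𝕍 − dim S_{a−1,b}^𝕍 = D^𝕍(a, b). -/
open Module Submodule LinearMap Finset

noncomputable section

/-- A persistence module of length `n` over a field `F`: finite-dimensional vector
spaces `V i` (indexed by `ℤ`, with the convention that `V i` is trivial for `i < 1`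
or `i > n`) together with structure maps `f i : V i → V (i+1)`. -/
structure PersMod (F : Type) [Field F] (n : ℕ) where
  V : ℤ → Type
  [acg : ∀ i, AddCommGroup (V i)]
  [mod : ∀ i, Module F (V i)]
  [fd : ∀ i, FiniteDimensional F (V i)]
  f : ∀ i : ℤ, V i →ₗ[F] V (i + 1)
  triv : ∀ i : ℤ, (i < 1 ∨ (n : ℤ) < i) → Subsingleton (V i)

attribute [instance] PersMod.acg PersMod.mod PersMod.fd

variable {F : Type} [Field F] {n : ℕ}

/-- Transport along an index equality. -/
def PersMod.castLM (M : PersMod F n) {i j : ℤ} (h : i = j) : M.V i →ₗ[F] M.V j := by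
  subst h; exact LinearMap.id

def PersMod.flAux (M : PersMod F n) (a : ℤ) : (k : ℕ) → (M.V a →ₗ[F] M.V (a + (k : ℤ)))
  | 0 => M.castLM (by simp)
  | (k + 1) => (M.castLM (by push_cast; ring)).comp ((M.f (a + (k : ℤ))).comp (M.flAux a k))

/-- The composite structure map `f_{a,b} : V a → V b` (the zero map if `b < a`);
`fl a a` is the identity. -/
def PersMod.fl (M : PersMod F n) (a b : ℤ) : M.V a →ₗ[F] M.V b :=
  if h : a ≤ b then (M.castLM (by omega)).comp (M.flAux a (b - a).toNat) else 0

/-- `S M a b = f_{a,b}(V a) ⊓ ker (f b)` when `1 ≤ a ≤ b ≤ n`, and `⊥` otherwise. -/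
def PersMod.S (M : PersMod F n) (a b : ℤ) : Submodule F (M.V b) :=
  if 1 ≤ a ∧ a ≤ b ∧ b ≤ (n : ℤ) then
    LinearMap.range (M.fl a b) ⊓ LinearMap.ker (M.f b)
  else ⊥

/-- The persistence diagram `D M a b = dim S_{a,b} - dim S_{a-1,b}` (as an integer). -/
def PersMod.D (M : PersMod F n) (a b : ℤ) : ℤ :=
  (Module.finrank F ↥(M.S a b) : ℤ) - (Module.finrank F ↥(M.S (a - 1) b) : ℤ)

/-- A morphism of persistence modules: linear maps commuting with structure maps. -/
structure PersHom (M N : PersMod F n) where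
  α : ∀ i : ℤ, M.V i →ₗ[F] N.V i
  comm : ∀ i : ℤ, (N.f i).comp (α i) = (α (i + 1)).comp (M.f i)

/-- `X^α(a,b,a',b')` from the paper. -/
def PersHom.X {M N : PersMod F n} (h : PersHom M N) (a b a' b' : ℤ) : ℤ :=
  if b' ≤ b ∧ b ≤ (n : ℤ) then
    (Module.finrank F
        ↥(M.S a b ⊓ Submodule.map (M.fl b' b) (Submodule.comap (h.α b') (N.S a' b'))) : ℤ)
      - (Module.finrank F
        ↥(M.S a b ⊓ Submodule.map (M.fl b' b) (LinearMap.ker (h.α b'))) : ℤ)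
  else 0

/-- The basis-independent partial matching `M^α` induced by `α`. -/
def PersHom.Mm {M N : PersMod F n} (h : PersHom M N) (a b a' b' : ℤ) : ℤ :=
  h.X a b a' b' - h.X (a - 1) b a' b' - h.X a b (a' - 1) b' + h.X (a - 1) b (a' - 1) b'

/-- The elder rule operator in the `i`-th variable. -/
def Efun {m : ℕ} (i : Fin m) (G : (Fin m → ℤ) → ℤ) : (Fin m → ℤ) → ℤ :=
  fun x => G x - G (Function.update x i (x i - 1))

/-- The restriction of a persistence module to a family of subspaces preserved
by the structure maps. -/
def PersMod.restrict (M : PersMod F n) (P : ∀ i : ℤ, Submodule F (M.V i))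
    (hP : ∀ i : ℤ, Submodule.map (M.f i) (P i) ≤ P (i + 1)) : PersMod F n where
  V i := ↥(P i)
  f i := (M.f i).restrict (fun x hx => hP i ⟨x, hx, rfl⟩)
  triv i hi := by
    have h := M.triv i hi
    exact ⟨fun a b => Subtype.ext (@Subsingleton.elim _ h _ _)⟩

/-- The restriction of a morphism of persistence modules to preserved families of
subspaces on source and target. -/
def PersHom.restrict {M N : PersMod F n} (h : PersHom M N)
    (P : ∀ i : ℤ, Submodule F (M.V i))
    (hP : ∀ i : ℤ, Submodule.map (M.f i) (P i) ≤ P (i + 1))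
    (Q : ∀ i : ℤ, Submodule F (N.V i))
    (hQ : ∀ i : ℤ, Submodule.map (N.f i) (Q i) ≤ Q (i + 1))
    (hα : ∀ i : ℤ, Submodule.map (h.α i) (P i) ≤ Q i) :
    PersHom (M.restrict P hP) (N.restrict Q hQ) where
  α i := (h.α i).restrict (fun x hx => hα i ⟨x, hx, rfl⟩)
  comm i := by
    ext x
    apply Subtype.ext
    show (N.f i) ((h.α i) x.1) = (h.α (i + 1)) ((M.f i) x.1)
    exact LinearMap.congr_fun (h.comm i) x.1

/-- The subspace `R(a,b,c,d)` (respectively `L(a',b',c,d)`, with `β` in place of `α`). -/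
def RL {V W : PersMod F n} (α : PersHom V W) (a b c d : ℤ) : Submodule F (W.V d) :=
  if a ≤ d ∧ c ≤ d ∧ d ≤ b then
    Submodule.map (α.α d) (LinearMap.range (V.fl a d) ⊓ LinearMap.ker (V.fl d (b + 1)))
      ⊓ W.S c d
  else ⊥

/-- `Y(a,b,a',b',c,d) = dim (R(a,b,c,d) ⊓ L(a',b',c,d))`. -/
def Yfun {V W U : PersMod F n} (α : PersHom V W) (β : PersHom U W)
    (a b a' b' c d : ℤ) : ℤ :=
  (Module.finrank F ↥(RL α a b c d ⊓ RL β a' b' c d) : ℤ)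

/-- `e_{c,d} = E_{1,2,3,4,5}(Y)(a,b,a',b',c,d)`. -/
def eG {V W U : PersMod F n} (α : PersHom V W) (β : PersHom U W)
    (a b a' b' c d : ℤ) : ℤ :=
  Efun (4 : Fin 6) (Efun 3 (Efun 2 (Efun 1 (Efun 0
    (fun x : Fin 6 → ℤ => Yfun α β (x 0) (x 1) (x 2) (x 3) (x 4) (x 5))))))
    ![a, b, a', b', c, d]

/-- The cardinality (with multiplicity) `#G^{α,β}(a,b,a',b')` of the enriched partial
matching: the sum of all positive `e_{c,d}` over `1 ≤ c ≤ d ≤ n`. -/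
def cardG {V W U : PersMod F n} (α : PersHom V W) (β : PersHom U W)
    (a b a' b' : ℤ) : ℤ :=
  ∑ d ∈ Finset.Icc (1 : ℤ) (n : ℤ), ∑ c ∈ Finset.Icc (1 : ℤ) d,
    if 0 < eG α β a b a' b' c d then eG α β a b a' b' c d else 0

theorem PersMod.castLM_rfl (M : PersMod F n) {i : ℤ} (h : i = i) :
    M.castLM h = LinearMap.id := rfl

theorem PersMod.fl_eq (M : PersMod F n) (a b : ℤ) (k : ℕ) (hk : a + (k : ℤ) = b) :
    M.fl a b = (M.castLM hk).comp (M.flAux a k) := by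
  have hab : a ≤ b := by omega
  have hk' : (b - a).toNat = k := by omega
  unfold PersMod.fl
  rw [dif_pos hab]
  subst hk'
  rfl

theorem PersMod.f_cast (M : PersMod F n) {i j : ℤ} (h : i = j) (h' : i + 1 = j + 1) :
    (M.f j).comp (M.castLM h) = (M.castLM h').comp (M.f i) := by
  subst h
  rfl

theorem PersMod.castLM_castLM (M : PersMod F n) {i j k : ℤ} (h : i = j) (h' : j = k)
    (x : M.V i) : M.castLM h' (M.castLM h x) = M.castLM (h.trans h') x := by
  subst h
  subst h'
  rfl

theorem PersMod.fl_self (M : PersMod F n) (a : ℤ) : M.fl a a = LinearMap.id := by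
  rw [M.fl_eq a a 0 (by simp)]
  ext x
  simp only [LinearMap.comp_apply, PersMod.flAux]
  rw [M.castLM_castLM]
  rfl

theorem PersMod.fl_succ (M : PersMod F n) (a b : ℤ) (hab : a ≤ b) :
    M.fl a (b + 1) = (M.f b).comp (M.fl a b) := by
  obtain ⟨k, hk⟩ := Int.le.dest hab
  rw [M.fl_eq a b k hk, M.fl_eq a (b + 1) (k + 1) (by push_cast; omega)]
  subst hk
  ext x
  simp only [LinearMap.comp_apply, PersMod.flAux]
  rw [M.castLM_castLM]
  rfl

theorem PersMod.fl_head (M : PersMod F n) (a b : ℤ) (hab : a + 1 ≤ b) :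
    M.fl a b = (M.fl (a + 1) b).comp (M.f a) := by
  induction b, hab using Int.leInduction with
  | base => rw [M.fl_succ a a le_rfl, M.fl_self, M.fl_self]; rfl
  | succ m hm ih =>
    rw [M.fl_succ a m (by omega), M.fl_succ (a + 1) m hm, ih, LinearMap.comp_assoc]

theorem PersMod.S_mono (M : PersMod F n) (a b : ℤ) (hab : a ≤ b) :
    M.S (a - 1) b ≤ M.S a b := by
  unfold PersMod.S
  split_ifs with h1 h2
  · refine inf_le_inf_right _ ?_
    obtain ⟨c, rfl⟩ : ∃ c, a = c + 1 := ⟨a - 1, by ring⟩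
    have e : c + 1 - 1 = c := by ring
    rw [e, M.fl_head c b hab]
    exact LinearMap.range_comp_le_range _ _
  · omega
  · exact bot_le
  · exact bot_le

theorem dimdiff_mono {W : Type} [AddCommGroup W] [Module F W] [FiniteDimensional F W]
    (A B T T' : Submodule F W) (hBA : B ≤ A) (hT : T ≤ T') :
    (finrank F ↥(A ⊓ T) : ℤ) - finrank F ↥(B ⊓ T) ≤
      (finrank F ↥(A ⊓ T') : ℤ) - finrank F ↥(B ⊓ T') := by
  have h := Submodule.finrank_sup_add_finrank_inf_eq (A ⊓ T) (B ⊓ T')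
  have e : (A ⊓ T) ⊓ (B ⊓ T') = B ⊓ T := by
    apply le_antisymm
    · exact le_inf (inf_le_right.trans inf_le_left) (inf_le_left.trans inf_le_right)
    · exact le_inf (inf_le_inf_right _ hBA) (inf_le_inf_left _ hT)
  have l : finrank F ↥((A ⊓ T) ⊔ (B ⊓ T')) ≤ finrank F ↥(A ⊓ T') :=
    Submodule.finrank_mono (sup_le (inf_le_inf_left _ hT) (inf_le_inf_right _ hBA))
  rw [e] at h
  omega

theorem sum_Icc_int_succ (g : ℤ → ℤ) (m : ℕ) :
    ∑ i ∈ Finset.Icc (1 : ℤ) ((m + 1 : ℕ) : ℤ), g i =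
      (∑ i ∈ Finset.Icc (1 : ℤ) (m : ℤ), g i) + g (m + 1) := by
  have e : Finset.Icc (1 : ℤ) ((m + 1 : ℕ) : ℤ) =
      insert ((m : ℤ) + 1) (Finset.Icc (1 : ℤ) (m : ℤ)) := by
    ext x
    simp only [Finset.mem_Icc, Finset.mem_insert]
    push_cast
    omega
  rw [e, Finset.sum_insert (by simp), add_comm]

theorem sum_tele (g : ℤ → ℤ) (m : ℕ) :
    ∑ i ∈ Finset.Icc (1 : ℤ) (m : ℤ), (g i - g (i - 1)) = g m - g 0 := by
  induction m with
  | zero => simp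
  | succ k ih =>
    rw [sum_Icc_int_succ, ih]
    have e : (k : ℤ) + 1 - 1 = k := by ring
    rw [e]
    push_cast
    ring

theorem sum_chain (t p q : ℤ → ℤ) (b K : ℤ) (hb : 1 ≤ b)
    (ht : ∀ i, i ≤ b → t i = p i - q i) (ht' : ∀ i, b < i → t i = 0)
    (hpq : ∀ i, i < b → p i ≤ q (i + 1)) (hq : 0 ≤ q 1) (hK : p b ≤ K) (m : ℕ) :
    ((m : ℤ) < b → ∑ i ∈ Finset.Icc (1 : ℤ) (m : ℤ), t i ≤ q (m + 1)) ∧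
    (b ≤ (m : ℤ) → ∑ i ∈ Finset.Icc (1 : ℤ) (m : ℤ), t i ≤ K) := by
  induction m with
  | zero =>
    refine ⟨fun _ => by simpa using hq, fun h => ?_⟩
    push_cast at h
    omega
  | succ k ih =>
    rw [sum_Icc_int_succ]
    push_cast
    obtain ⟨i1, i2⟩ := ih
    refine ⟨fun h => ?_, fun h => ?_⟩
    · have := i1 (by omega)
      have := ht (k + 1) (by omega)
      have := hpq (k + 1) (by omega)
      omega
    · by_cases hk : b ≤ (k : ℤ)
      · have := i2 hk
        have := ht' (k + 1) (by omega)
        omega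
      · have := i1 (by omega)
        have := ht (k + 1) (by omega)
        have e : b = (k : ℤ) + 1 := by omega
        rw [e] at hK
        omega

theorem PersHom.X_zero {M N : PersMod F n} (h : PersHom M N) (a b b' : ℤ) :
    h.X a b 0 b' = 0 := by
  unfold PersHom.X
  have e : N.S 0 b' = ⊥ := by
    unfold PersMod.S
    rw [if_neg (by omega)]
  rw [e, Submodule.comap_bot]
  simp

theorem PersHom.chain {M N : PersMod F n} (h : PersHom M N) (b i : ℤ) (hi : i < b) :
    Submodule.map (M.fl i b) (Submodule.comap (h.α i) (N.S i i)) ≤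
      Submodule.map (M.fl (i + 1) b) (LinearMap.ker (h.α (i + 1))) := by
  rintro _ ⟨x, hx, rfl⟩
  refine ⟨M.f i x, ?_, ?_⟩
  · have hx' : N.f i (h.α i x) = 0 := by
      have hx2 : h.α i x ∈ N.S i i := hx
      unfold PersMod.S at hx2
      split_ifs at hx2 with hc
      · exact hx2.2
      · rw [(Submodule.mem_bot F).1 hx2, map_zero]
    have hc := LinearMap.congr_fun (h.comm i) x
    simp only [LinearMap.comp_apply] at hc
    change h.α (i + 1) (M.f i x) = 0
    rw [← hc, hx']
  · rw [M.fl_head i b (by omega)]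
    rfl

theorem PersHom.sum_Mm {M N : PersMod F n} (h : PersHom M N) (a b b' : ℤ) (hb : 1 ≤ b') :
    ∑ a' ∈ Finset.Icc (1 : ℤ) b', h.Mm a b a' b' = h.X a b b' b' - h.X (a - 1) b b' b' := by
  obtain ⟨k, rfl⟩ := Int.eq_ofNat_of_zero_le (show 0 ≤ b' by omega)
  have := sum_tele (fun a' => h.X a b a' k - h.X (a - 1) b a' k) k
  simp only [PersHom.X_zero] at this
  rw [sub_self, sub_zero] at this
  rw [← this]
  refine Finset.sum_congr rfl fun a' _ => ?_
  unfold PersHom.Mm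
  ring

/-- Theorem 2 of the paper, first inequality:
`∑_{b'=1}^{n} ∑_{a'=1}^{b'} M^α(a,b,a',b') ≤ dim S^V_{a,b} - dim S^V_{a-1,b} = D^V(a,b)`. -/
theorem stmt10 (Vm Um : PersMod F n) (h : PersHom Vm Um) (a b : ℤ)
    (ha : 1 ≤ a) (hab : a ≤ b) (hbn : b ≤ (n : ℤ)) :
    (∑ b' ∈ Finset.Icc (1 : ℤ) (n : ℤ), ∑ a' ∈ Finset.Icc (1 : ℤ) b', h.Mm a b a' b') ≤
        (Module.finrank F ↥(Vm.S a b) : ℤ) - (Module.finrank F ↥(Vm.S (a - 1) b) : ℤ) ∧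
      (Module.finrank F ↥(Vm.S a b) : ℤ) - (Module.finrank F ↥(Vm.S (a - 1) b) : ℤ) =
        Vm.D a b := by
  refine ⟨?_, rfl⟩
  rw [Finset.sum_congr rfl (fun b' hb' => h.sum_Mm a b b' (Finset.mem_Icc.1 hb').1)]
  have hBA := Vm.S_mono a b hab
  let P : ℤ → Submodule F (Vm.V b) := fun i =>
    Submodule.map (Vm.fl i b) (Submodule.comap (h.α i) (Um.S i i))
  let Q : ℤ → Submodule F (Vm.V b) := fun i =>
    Submodule.map (Vm.fl i b) (LinearMap.ker (h.α i))
  let g : Submodule F (Vm.V b) → ℤ := fun T =>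
    (finrank F ↥(Vm.S a b ⊓ T) : ℤ) - finrank F ↥(Vm.S (a - 1) b ⊓ T)
  have hg : ∀ T T', T ≤ T' → g T ≤ g T' := fun T T' hT =>
    dimdiff_mono _ _ T T' hBA hT
  refine (sum_chain _ (fun i => g (P i)) (fun i => g (Q i)) b _ (by omega) ?_ ?_ ?_ ?_ ?_ n).2 hbn
  · intro i hi
    simp only [PersHom.X, if_pos (show i ≤ b ∧ b ≤ (n : ℤ) from ⟨hi, hbn⟩), g, P, Q]
    ring
  · intro i hi
    simp only [PersHom.X, if_neg (show ¬ (i ≤ b ∧ b ≤ (n : ℤ)) by omega)]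
    ring
  · intro i hi
    exact hg _ _ (h.chain b i hi)
  · have h0 := hg ⊥ (Q 1) bot_le
    have e : g ⊥ = 0 := by
      change (finrank F ↥(Vm.S a b ⊓ ⊥) : ℤ) - finrank F ↥(Vm.S (a - 1) b ⊓ ⊥) = 0
      rw [inf_bot_eq, inf_bot_eq, sub_self]
    rw [e] at h0
    exact h0
  · have h1 := hg (P b) ⊤ le_top
    have e : g ⊤ = (finrank F ↥(Vm.S a b) : ℤ) - finrank F ↥(Vm.S (a - 1) b) := by
      change (finrank F ↥(Vm.S a b ⊓ ⊤) : ℤ) - finrank F ↥(Vm.S (a - 1) b ⊓ ⊤) = _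
      rw [inf_top_eq, inf_top_eq]
    rw [e] at h1
    exact h1
end
end

section
/- Let α : 𝕍 → 𝕌 be a morphism between persistence modules of length n that is the internal direct sum of two morphisms α¹ : 𝕍¹ → 𝕌¹ and α² : 𝕍² → 𝕌² (i.e., V_i = V_i¹ ⊕ V_i², U_i = U_i¹ ⊕ U_i² are internal direct sum decompositions preserved by the structure maps, and α_i(V_i^k) ⊆ U_i^k with restriction α_i^k, k = 1, 2). Then the basis-independent partial matching is additive: M^α(a, b, a', b') = M^{α¹}(a, b, a', b') + M^{α²}(a, b, a', b') for all integers a, b, a', b'. -/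
open Module Submodule LinearMap Finset

noncomputable section

variable {F : Type} [Field F] {n : ℕ}

/-- `T` is the direct sum of `T1` and `T2` along the maps `i1`, `i2`. -/
def SplitSub {E E1 E2 : Type} [AddCommGroup E] [AddCommGroup E1] [AddCommGroup E2]
    [Module F E] [Module F E1] [Module F E2] (i1 : E1 →ₗ[F] E) (i2 : E2 →ₗ[F] E)
    (T : Submodule F E) (T1 : Submodule F E1) (T2 : Submodule F E2) : Prop :=
  ∀ x y, i1 x + i2 y ∈ T ↔ x ∈ T1 ∧ y ∈ T2

section SplitLemmas

variable {E E1 E2 G G1 G2 : Type} [AddCommGroup E] [AddCommGroup E1] [AddCommGroup E2]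
    [Module F E] [Module F E1] [Module F E2] [AddCommGroup G] [AddCommGroup G1] [AddCommGroup G2]
    [Module F G] [Module F G1] [Module F G2]
    {i1 : E1 →ₗ[F] E} {i2 : E2 →ₗ[F] E} {j1 : G1 →ₗ[F] G} {j2 : G2 →ₗ[F] G}

theorem SplitSub.inf {T T' : Submodule F E} {T1 T1' : Submodule F E1} {T2 T2' : Submodule F E2}
    (h : SplitSub i1 i2 T T1 T2) (h' : SplitSub i1 i2 T' T1' T2') :
    SplitSub i1 i2 (T ⊓ T') (T1 ⊓ T1') (T2 ⊓ T2') := by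
  intro x y
  simp only [Submodule.mem_inf, h x y, h' x y]
  tauto

theorem SplitSub.bot (hi : Function.Bijective (i1.coprod i2)) : SplitSub i1 i2 ⊥ ⊥ ⊥ := by
  intro x y
  simp only [Submodule.mem_bot]
  constructor
  · intro h
    have : (x, y) = (0 : E1 × E2) := hi.1 (by simpa using h)
    simpa using this
  · rintro ⟨rfl, rfl⟩
    simp

theorem SplitSub.top : SplitSub i1 i2 ⊤ ⊤ ⊤ := by
  intro x y
  simp

theorem SplitSub.comap {f : E →ₗ[F] G} {f1 : E1 →ₗ[F] G1} {f2 : E2 →ₗ[F] G2}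
    (h1 : ∀ x, j1 (f1 x) = f (i1 x)) (h2 : ∀ x, j2 (f2 x) = f (i2 x))
    {T : Submodule F G} {T1 : Submodule F G1} {T2 : Submodule F G2}
    (h : SplitSub j1 j2 T T1 T2) :
    SplitSub i1 i2 (T.comap f) (T1.comap f1) (T2.comap f2) := by
  intro x y
  simp only [Submodule.mem_comap, map_add, ← h1, ← h2, h (f1 x) (f2 y)]

theorem SplitSub.ker {f : E →ₗ[F] G} {f1 : E1 →ₗ[F] G1} {f2 : E2 →ₗ[F] G2}
    (hj : Function.Bijective (j1.coprod j2))
    (h1 : ∀ x, j1 (f1 x) = f (i1 x)) (h2 : ∀ x, j2 (f2 x) = f (i2 x)) :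
    SplitSub i1 i2 (LinearMap.ker f) (LinearMap.ker f1) (LinearMap.ker f2) :=
  SplitSub.comap h1 h2 (SplitSub.bot hj)

theorem SplitSub.map {f : E →ₗ[F] G} {f1 : E1 →ₗ[F] G1} {f2 : E2 →ₗ[F] G2}
    (hi : Function.Bijective (i1.coprod i2)) (hj : Function.Bijective (j1.coprod j2))
    (h1 : ∀ x, j1 (f1 x) = f (i1 x)) (h2 : ∀ x, j2 (f2 x) = f (i2 x))
    {T : Submodule F E} {T1 : Submodule F E1} {T2 : Submodule F E2}
    (h : SplitSub i1 i2 T T1 T2) :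
    SplitSub j1 j2 (T.map f) (T1.map f1) (T2.map f2) := by
  intro x y
  constructor
  · rintro ⟨z, hz, hzx⟩
    obtain ⟨⟨u, v⟩, rfl⟩ := hi.2 z
    have hz' : i1 u + i2 v ∈ T := by simpa using hz
    have : (f1 u, f2 v) = (x, y) := hj.1 (by simpa [h1, h2] using hzx)
    obtain ⟨rfl, rfl⟩ := Prod.mk.inj this
    obtain ⟨hu, hv⟩ := (h u v).1 hz'
    exact ⟨⟨u, hu, rfl⟩, ⟨v, hv, rfl⟩⟩
  · rintro ⟨⟨u, hu, rfl⟩, ⟨v, hv, rfl⟩⟩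
    exact ⟨i1 u + i2 v, (h u v).2 ⟨hu, hv⟩, by rw [map_add, h1, h2]⟩

theorem SplitSub.finrank [FiniteDimensional F E1] [FiniteDimensional F E2]
    (hi : Function.Bijective (i1.coprod i2))
    {T : Submodule F E} {T1 : Submodule F E1} {T2 : Submodule F E2}
    (h : SplitSub i1 i2 T T1 T2) :
    Module.finrank F T = Module.finrank F T1 + Module.finrank F T2 := by
  have key : T = (T1.prod T2).map (i1.coprod i2) := by
    ext z
    obtain ⟨⟨u, v⟩, rfl⟩ := hi.2 z
    rw [Submodule.mem_map]
    constructor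
    · intro hz
      exact ⟨(u, v), (h u v).1 (by simpa using hz), rfl⟩
    · rintro ⟨⟨u', v'⟩, huv, e⟩
      rw [← e]
      simpa using (h u' v').2 huv
  rw [key, ← LinearEquiv.finrank_eq (Submodule.equivMapOfInjective _ hi.1 (T1.prod T2)),
    ← Module.finrank_prod]
  exact LinearEquiv.finrank_eq
    { toFun := fun z => (⟨z.1.1, z.2.1⟩, ⟨z.1.2, z.2.2⟩)
      invFun := fun z => ⟨(z.1.1, z.2.1), z.1.2, z.2.2⟩
      map_add' := fun _ _ => rfl
      map_smul' := fun _ _ => rfl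
      left_inv := fun _ => rfl
      right_inv := fun _ => rfl }

end SplitLemmas

/-- Inclusion of the restriction. -/
def PersMod.incl (M : PersMod F n) (P : ∀ i : ℤ, Submodule F (M.V i))
    (hP : ∀ i : ℤ, Submodule.map (M.f i) (P i) ≤ P (i + 1)) (i : ℤ) :
    (M.restrict P hP).V i →ₗ[F] M.V i := (P i).subtype

section

variable (M : PersMod F n) (P : ∀ i : ℤ, Submodule F (M.V i))
    (hP : ∀ i : ℤ, Submodule.map (M.f i) (P i) ≤ P (i + 1))

theorem PersMod.incl_f (i : ℤ) (x : (M.restrict P hP).V i) :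
    M.incl P hP (i + 1) ((M.restrict P hP).f i x) = M.f i (M.incl P hP i x) := rfl

theorem PersMod.incl_cast {i j : ℤ} (e : i = j) (x : (M.restrict P hP).V i) :
    M.incl P hP j ((M.restrict P hP).castLM e x) = M.castLM e (M.incl P hP i x) := by
  subst e
  rfl

theorem PersMod.incl_flAux (a : ℤ) (k : ℕ) (x : (M.restrict P hP).V a) :
    M.incl P hP (a + k) ((M.restrict P hP).flAux a k x) = M.flAux a k (M.incl P hP a x) := by
  induction k with
  | zero => exact M.incl_cast P hP _ x
  | succ k ih =>
    simp only [PersMod.flAux, LinearMap.comp_apply]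
    rw [← ih, ← PersMod.incl_f]
    exact M.incl_cast P hP _ _

theorem PersMod.incl_fl (a b : ℤ) (x : (M.restrict P hP).V a) :
    M.incl P hP b ((M.restrict P hP).fl a b x) = M.fl a b (M.incl P hP a x) := by
  unfold PersMod.fl
  split_ifs with h
  · simp only [LinearMap.comp_apply]
    rw [← PersMod.incl_flAux]
    exact M.incl_cast P hP _ _
  · simp

variable (P' : ∀ i : ℤ, Submodule F (M.V i))
    (hP' : ∀ i : ℤ, Submodule.map (M.f i) (P' i) ≤ P' (i + 1))

theorem PersMod.incl_bij (hc : ∀ i : ℤ, IsCompl (P i) (P' i)) (i : ℤ) :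
    Function.Bijective ((M.incl P hP i).coprod (M.incl P' hP' i)) :=
  (Submodule.prodEquivOfIsCompl _ _ (hc i)).bijective

theorem PersMod.split_S (hc : ∀ i : ℤ, IsCompl (P i) (P' i)) (a b : ℤ) :
    SplitSub (M.incl P hP b) (M.incl P' hP' b) (M.S a b)
      ((M.restrict P hP).S a b) ((M.restrict P' hP').S a b) := by
  unfold PersMod.S
  split_ifs with h
  · apply SplitSub.inf
    · rw [LinearMap.range_eq_map, LinearMap.range_eq_map, LinearMap.range_eq_map]
      exact SplitSub.map (M.incl_bij P hP P' hP' hc a) (M.incl_bij P hP P' hP' hc b)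
        (M.incl_fl P hP a b) (M.incl_fl P' hP' a b) SplitSub.top
    · exact SplitSub.comap (M.incl_f P hP b) (M.incl_f P' hP' b)
        (SplitSub.bot (M.incl_bij P hP P' hP' hc (b + 1)))
  · exact SplitSub.bot (M.incl_bij P hP P' hP' hc b)

end

theorem X_add (Vm Um : PersMod F n) (h : PersHom Vm Um)
    (P1 P2 : ∀ i : ℤ, Submodule F (Vm.V i)) (Q1 Q2 : ∀ i : ℤ, Submodule F (Um.V i))
    (hPcompl : ∀ i : ℤ, IsCompl (P1 i) (P2 i)) (hQcompl : ∀ i : ℤ, IsCompl (Q1 i) (Q2 i))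
    (hP1 : ∀ i : ℤ, Submodule.map (Vm.f i) (P1 i) ≤ P1 (i + 1))
    (hP2 : ∀ i : ℤ, Submodule.map (Vm.f i) (P2 i) ≤ P2 (i + 1))
    (hQ1 : ∀ i : ℤ, Submodule.map (Um.f i) (Q1 i) ≤ Q1 (i + 1))
    (hQ2 : ∀ i : ℤ, Submodule.map (Um.f i) (Q2 i) ≤ Q2 (i + 1))
    (hα1 : ∀ i : ℤ, Submodule.map (h.α i) (P1 i) ≤ Q1 i)
    (hα2 : ∀ i : ℤ, Submodule.map (h.α i) (P2 i) ≤ Q2 i)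
    (a b a' b' : ℤ) :
    h.X a b a' b' =
      (h.restrict P1 hP1 Q1 hQ1 hα1).X a b a' b' +
        (h.restrict P2 hP2 Q2 hQ2 hα2).X a b a' b' := by
  have bi := Vm.incl_bij P1 hP1 P2 hP2 hPcompl
  have bj := Um.incl_bij Q1 hQ1 Q2 hQ2 hQcompl
  have c1 : ∀ x, Um.incl Q1 hQ1 b' ((h.restrict P1 hP1 Q1 hQ1 hα1).α b' x)
      = h.α b' (Vm.incl P1 hP1 b' x) := fun x => rfl
  have c2 : ∀ x, Um.incl Q2 hQ2 b' ((h.restrict P2 hP2 Q2 hQ2 hα2).α b' x)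
      = h.α b' (Vm.incl P2 hP2 b' x) := fun x => rfl
  have sS := Vm.split_S P1 hP1 P2 hP2 hPcompl a b
  have e1 := SplitSub.finrank (bi b) (sS.inf (SplitSub.map (bi b') (bi b)
    (Vm.incl_fl P1 hP1 b' b) (Vm.incl_fl P2 hP2 b' b)
    (SplitSub.comap c1 c2 (Um.split_S Q1 hQ1 Q2 hQ2 hQcompl a' b'))))
  have e2 := SplitSub.finrank (bi b) (sS.inf (SplitSub.map (bi b') (bi b)
    (Vm.incl_fl P1 hP1 b' b) (Vm.incl_fl P2 hP2 b' b)
    (SplitSub.ker (bj b') c1 c2)))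
  unfold PersHom.X
  split_ifs with hb
  · rw [e1, e2]
    push_cast
    ring
  · simp

/-- Proposition 2 of the paper (linearity): if `α : 𝕍 → 𝕌` is the internal direct sum
of `α¹ : 𝕍¹ → 𝕌¹` and `α² : 𝕍² → 𝕌²`, then `M^α = M^{α¹} + M^{α²}`. -/
theorem stmt14 (Vm Um : PersMod F n) (h : PersHom Vm Um)
    (P1 P2 : ∀ i : ℤ, Submodule F (Vm.V i)) (Q1 Q2 : ∀ i : ℤ, Submodule F (Um.V i))
    (hPcompl : ∀ i : ℤ, IsCompl (P1 i) (P2 i)) (hQcompl : ∀ i : ℤ, IsCompl (Q1 i) (Q2 i))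
    (hP1 : ∀ i : ℤ, Submodule.map (Vm.f i) (P1 i) ≤ P1 (i + 1))
    (hP2 : ∀ i : ℤ, Submodule.map (Vm.f i) (P2 i) ≤ P2 (i + 1))
    (hQ1 : ∀ i : ℤ, Submodule.map (Um.f i) (Q1 i) ≤ Q1 (i + 1))
    (hQ2 : ∀ i : ℤ, Submodule.map (Um.f i) (Q2 i) ≤ Q2 (i + 1))
    (hα1 : ∀ i : ℤ, Submodule.map (h.α i) (P1 i) ≤ Q1 i)
    (hα2 : ∀ i : ℤ, Submodule.map (h.α i) (P2 i) ≤ Q2 i)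
    (a b a' b' : ℤ) :
    h.Mm a b a' b' =
      (h.restrict P1 hP1 Q1 hQ1 hα1).Mm a b a' b' +
        (h.restrict P2 hP2 Q2 hQ2 hα2).Mm a b a' b' := by
  unfold PersHom.Mm
  rw [X_add Vm Um h P1 P2 Q1 Q2 hPcompl hQcompl hP1 hP2 hQ1 hQ2 hα1 hα2 a b a' b',
    X_add Vm Um h P1 P2 Q1 Q2 hPcompl hQcompl hP1 hP2 hQ1 hQ2 hα1 hα2 (a - 1) b a' b',
    X_add Vm Um h P1 P2 Q1 Q2 hPcompl hQcompl hP1 hP2 hQ1 hQ2 hα1 hα2 a b (a' - 1) b',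
    X_add Vm Um h P1 P2 Q1 Q2 hPcompl hQcompl hP1 hP2 hQ1 hQ2 hα1 hα2 (a - 1) b (a' - 1) b']
  ring
end
end

section
/- Let 𝕍 →^α 𝕎 ←^β 𝕌 be a pair of morphisms between persistence modules of length n. For integers with a, c ≤ d ≤ b one has R(a, b, c, d) = f_{a,d}^𝕎( α_a( ker f_{a,b+1}^𝕍 ) ) ∩ S_{c,d}^𝕎, and for a', c ≤ d ≤ b' one has L(a', b', c, d) = f_{a',d}^𝕎( β_{a'}( ker f_{a',b'+1}^𝕌 ) ) ∩ S_{c,d}^𝕎. -/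
open Module Submodule LinearMap Finset

noncomputable section

variable {F : Type} [Field F] {n : ℕ}

theorem PersMod.fl_aux_eq (M : PersMod F n) (a b : ℤ) (k : ℕ) (h : a + (k : ℤ) = b) :
    M.fl a b = (M.castLM h).comp (M.flAux a k) := by
  have hab : a ≤ b := by omega
  have hk : (b - a).toNat = k := by omega
  subst hk
  simp [PersMod.fl, hab]

theorem PersMod.fl_trans (M : PersMod F n) (a d b : ℤ) (had : a ≤ d) (hdb : d ≤ b) :
    (M.fl d b).comp (M.fl a d) = M.fl a b := by
  induction b, hdb using Int.le_induction with
  | base => rw [M.fl_self]; rfl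
  | succ b hb ih =>
    rw [M.fl_succ d b hb, M.fl_succ a b (by omega), ← ih]; rfl

theorem PersHom.fl_comm {M N : PersMod F n} (h : PersHom M N) (a b : ℤ) (hab : a ≤ b) :
    (N.fl a b).comp (h.α a) = (h.α b).comp (M.fl a b) := by
  induction b, hab using Int.le_induction with
  | base => rw [M.fl_self, N.fl_self]; rfl
  | succ b hb ih =>
    rw [M.fl_succ a b hb, N.fl_succ a b hb, LinearMap.comp_assoc, ih,
      ← LinearMap.comp_assoc, h.comm, LinearMap.comp_assoc]

theorem RL_eq {V W : PersMod F n} (α : PersHom V W) (a b c d : ℤ)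
    (had : a ≤ d) (hcd : c ≤ d) (hdb : d ≤ b) :
    RL α a b c d =
      Submodule.map (W.fl a d)
        (Submodule.map (α.α a) (LinearMap.ker (V.fl a (b + 1)))) ⊓ W.S c d := by
  rw [RL, if_pos ⟨had, hcd, hdb⟩, ← Submodule.map_comp, α.fl_comm a d had,
    Submodule.map_comp, ← V.fl_trans a d (b + 1) had (by omega), LinearMap.ker_comp,
    Submodule.map_comap_eq]

/-- Lemma 10 of the paper: alternative expressions for `R(a,b,c,d)` and `L(a',b',c,d)`. -/
theorem stmt15 (V W U : PersMod F n) (α : PersHom V W) (β : PersHom U W) :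
    (∀ a b c d : ℤ, a ≤ d → c ≤ d → d ≤ b →
      RL α a b c d =
        Submodule.map (W.fl a d)
            (Submodule.map (α.α a) (LinearMap.ker (V.fl a (b + 1)))) ⊓ W.S c d) ∧
    (∀ a' b' c d : ℤ, a' ≤ d → c ≤ d → d ≤ b' →
      RL β a' b' c d =
        Submodule.map (W.fl a' d)
            (Submodule.map (β.α a') (LinearMap.ker (U.fl a' (b' + 1)))) ⊓ W.S c d) := by
  exact ⟨fun a b c d => RL_eq α a b c d, fun a b c d => RL_eq β a b c d⟩
end
end
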